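/- Fix an integer d ≥ 3 and integers a, b with 0 < a < b < d and gcd(a,b,d) = 1, and let N_t and θ = θ(a,b,d) be as defined. Then in the ring of formal power series over ℤ, (1 − z)³ · Σ_{t ≥ 0} (2·N_t)·z^t = (d − θ + 2)·z² + (d + θ − 4)·z + 2. -/

import Mathlib

open Finset

/-- Solutions of a linear congruence modulo `d` among the first `t * d` natural numbers. -/
theorem card_filter_range_dvd_mul_add (d a c t : ℕ) (hd : 0 < d) :
    #{x ∈ range (t * d) | d ∣ a * x + c} = if a.gcd d ∣ c then t * a.gcd d else 0 := by
  have hg : 0 < a.gcd d := Nat.gcd_pos_of_pos_right _ hd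
  split_ifs with h
  · obtain ⟨x₀, hx₀⟩ : ∃ x₀, d ∣ a * x₀ + c := by
      obtain ⟨k, rfl⟩ := h
      have : NeZero d := ⟨hd.ne'⟩
      refine ⟨(-(a.gcdA d : ZMod d) * k).val, ?_⟩
      rw [← ZMod.natCast_eq_zero_iff]
      have hb := congrArg (Int.cast : ℤ → ZMod d) (Nat.gcd_eq_gcd_ab a d)
      push_cast at hb
      push_cast
      rw [ZMod.natCast_zmod_val, hb, ZMod.natCast_self]
      ring
    have hiff : ∀ x, d ∣ a * x + c ↔ x ≡ x₀ [MOD d / a.gcd d] := by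
      intro x
      constructor
      · intro hx
        have h1 : a * x + c ≡ a * x₀ + c [MOD d] :=
          ((Nat.modEq_zero_iff_dvd).2 hx).trans ((Nat.modEq_zero_iff_dvd).2 hx₀).symm
        have h2 := Nat.ModEq.cancel_left_div_gcd hd (Nat.ModEq.add_right_cancel' c h1)
        rwa [Nat.gcd_comm] at h2
      · intro hx
        have h1 : a * x ≡ a * x₀ [MOD d] := by
          have h2 : a.gcd d * x ≡ a.gcd d * x₀ [MOD d] := by
            have := Nat.ModEq.mul_left' (a.gcd d) hx
            rwa [Nat.mul_div_cancel' (Nat.gcd_dvd_right a d)] at this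
          have h3 := h2.mul_left (a / a.gcd d)
          rwa [← mul_assoc, ← mul_assoc, Nat.div_mul_cancel (Nat.gcd_dvd_left a d)] at h3
        exact (Nat.modEq_zero_iff_dvd).1
          ((h1.add_right c).trans ((Nat.modEq_zero_iff_dvd).2 hx₀))
    have hq : 0 < d / a.gcd d := Nat.div_pos (Nat.gcd_le_right _ hd) hg
    have hd' : t * d = d / a.gcd d * (t * a.gcd d) := by
      conv_lhs => rw [← Nat.div_mul_cancel (Nat.gcd_dvd_right a d)]
      ring
    simp_rw [hiff]
    rw [← Nat.count_eq_card_filter_range, Nat.count_modEq_card _ hq, hd',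
      Nat.mul_div_cancel_left _ hq, Nat.mul_mod_right]
    simp
  · rw [card_eq_zero, filter_eq_empty_iff]
    intro x _ hx
    exact h ((Nat.dvd_add_right ((Nat.gcd_dvd_left a d).mul_right x)).1
      ((Nat.gcd_dvd_right a d).trans hx))

theorem card_filter_range_dvd_mul (d c t : ℕ) (hd : 0 < d) :
    #{x ∈ range (t * d) | d ∣ c * x} = t * c.gcd d := by
  simpa using card_filter_range_dvd_mul_add d c 0 t hd

theorem card_filter_range_succ_dvd_mul (d c t : ℕ) (hd : 0 < d) :
    #{x ∈ range (t * d + 1) | d ∣ c * x} = t * c.gcd d + 1 := by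
  rw [range_add_one, filter_insert, if_pos (((dvd_mul_left d t).mul_left c)),
    card_insert_of_notMem (by simp), card_filter_range_dvd_mul d c t hd]

/-- Points of the lattice `d ∣ a * x + b * y` in a half-open square of side `t * d`. -/
theorem card_filter_square_dvd (d a b t : ℕ) (hd : 0 < d) (h : Nat.gcd a (Nat.gcd b d) = 1) :
    ∑ y ∈ range (t * d), #{x ∈ range (t * d) | d ∣ a * x + b * y} = t ^ 2 * d := by
  have hgd : a.gcd d ∣ d := Nat.gcd_dvd_right a d
  have hg : 0 < a.gcd d := Nat.gcd_pos_of_pos_right _ hd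
  have hcop : b.gcd (a.gcd d) = 1 := by
    rw [← h, ← Nat.gcd_assoc, ← Nat.gcd_assoc, Nat.gcd_comm b a]
  have hsum : t * d = (t * (d / a.gcd d)) * a.gcd d := by
    rw [mul_assoc, Nat.div_mul_cancel hgd]
  simp_rw [card_filter_range_dvd_mul_add d a _ t hd]
  rw [← sum_filter, sum_const, smul_eq_mul, hsum,
    card_filter_range_dvd_mul (a.gcd d) b (t * (d / a.gcd d)) hg, hcop]
  conv_rhs => rw [← Nat.div_mul_cancel hgd]
  ring

/-- Points of the lattice `d ∣ a * x + b * y` in a closed square of side `t * d`. -/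
theorem card_filter_closed_square_dvd (d a b t : ℕ) (hd : 0 < d)
    (h : Nat.gcd a (Nat.gcd b d) = 1) :
    #{p ∈ range (t * d + 1) ×ˢ range (t * d + 1) | d ∣ a * p.1 + b * p.2} =
      t ^ 2 * d + t * a.gcd d + t * b.gcd d + 1 := by
  have htd : d ∣ t * d := dvd_mul_left d t
  have hrow : ∀ y, #{x ∈ range (t * d + 1) | d ∣ a * x + b * y} =
      #{x ∈ range (t * d) | d ∣ a * x + b * y} + if d ∣ b * y then 1 else 0 := by
    intro y
    simp only [card_filter, sum_range_succ, Nat.dvd_add_right (htd.mul_left a)]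
  have hsq : #{p ∈ range (t * d + 1) ×ˢ range (t * d + 1) | d ∣ a * p.1 + b * p.2} =
      ∑ y ∈ range (t * d + 1), #{x ∈ range (t * d + 1) | d ∣ a * x + b * y} := by
    simp only [card_filter, sum_product_right]
  rw [hsq]
  simp_rw [hrow]
  rw [sum_add_distrib, ← card_filter, card_filter_range_succ_dvd_mul d b t hd, sum_range_succ,
    card_filter_square_dvd d a b t hd h]
  simp_rw [Nat.dvd_add_left (htd.mul_left b)]
  rw [card_filter_range_dvd_mul d a t hd]
  ring

/-- Points of the lattice `d ∣ a * x + b * y` on the segment `x + y = t * d`. -/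
theorem card_filter_antidiagonal_dvd (d a b t : ℕ) (hd : 0 < d) (hab : a ≤ b) :
    #{p ∈ antidiagonal (t * d) | d ∣ a * p.1 + b * p.2} = t * (b - a).gcd d + 1 := by
  rw [← card_filter_range_succ_dvd_mul d (b - a) t hd]
  have hiff : ∀ x y, x + y = t * d → (d ∣ a * x + b * y ↔ d ∣ (b - a) * x) := by
    intro x y hxy
    obtain ⟨e, rfl⟩ := Nat.exists_eq_add_of_le hab
    have hs : a * x + (a + e) * y + e * x = (a + e) * (t * d) := by rw [← hxy]; ring
    have hdvd : d ∣ a * x + (a + e) * y + e * x := hs ▸ (dvd_mul_left d t).mul_left _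
    rw [Nat.add_sub_cancel_left]
    exact ⟨fun h => (Nat.dvd_add_right h).1 hdvd, fun h => (Nat.dvd_add_left h).1 hdvd⟩
  refine card_nbij' Prod.fst (fun x => (x, t * d - x)) ?_ ?_ ?_ ?_
  · rintro ⟨x, y⟩ hp
    simp only [coe_filter, Set.mem_ofPred_eq, HasAntidiagonal.mem_antidiagonal, mem_range] at hp ⊢
    exact ⟨by omega, (hiff x y hp.1).1 hp.2⟩
  · intro x hx
    simp only [coe_filter, Set.mem_ofPred_eq, HasAntidiagonal.mem_antidiagonal, mem_range] at hx ⊢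
    exact ⟨by omega, (hiff x _ (by omega)).2 hx.2⟩
  · rintro ⟨x, y⟩ hp
    simp only [coe_filter, Set.mem_ofPred_eq, HasAntidiagonal.mem_antidiagonal] at hp
    simp only [Prod.mk.injEq, true_and]
    omega
  · intro x _
    rfl

/-- Points of the lattice `d ∣ a * x + b * y` in a closed triangle of side `t * d`, counted twice:
reflecting the square in its centre exchanges the two triangles cut off by the antidiagonal. -/
theorem two_mul_card_filter_triangle_dvd (d a b t : ℕ) (hd : 0 < d) (hab : a ≤ b)
    (h : Nat.gcd a (Nat.gcd b d) = 1) :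
    2 * #{p ∈ range (t * d + 1) ×ˢ range (t * d + 1) |
        p.1 + p.2 ≤ t * d ∧ d ∣ a * p.1 + b * p.2} =
      t ^ 2 * d + t * (a.gcd d + b.gcd d + (b - a).gcd d) + 2 := by
  have htd : d ∣ t * d := dvd_mul_left d t
  set Q := range (t * d + 1) ×ˢ range (t * d + 1) with hQ
  have hrefl_dvd : ∀ x y, x ≤ t * d → y ≤ t * d → d ∣ a * x + b * y →
      d ∣ a * (t * d - x) + b * (t * d - y) := by
    intro x y hx hy hxy
    refine (Nat.dvd_add_right hxy).1 ?_
    have hs : a * x + b * y + (a * (t * d - x) + b * (t * d - y)) = (a + b) * (t * d) := by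
      obtain ⟨u, hu⟩ := Nat.exists_eq_add_of_le hx
      obtain ⟨v, hv⟩ := Nat.exists_eq_add_of_le hy
      have hu' : t * d - x = u := by omega
      have hv' : t * d - y = v := by omega
      rw [hu', hv', add_mul]
      nth_rewrite 1 [hu]
      rw [hv]
      ring
    exact hs ▸ htd.mul_left _
  have hreflect : #{p ∈ Q | t * d ≤ p.1 + p.2 ∧ d ∣ a * p.1 + b * p.2} =
      #{p ∈ Q | p.1 + p.2 ≤ t * d ∧ d ∣ a * p.1 + b * p.2} := by
    refine card_nbij' (fun p => (t * d - p.1, t * d - p.2))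
      (fun p => (t * d - p.1, t * d - p.2)) ?_ ?_ ?_ ?_
    all_goals
      rintro ⟨x, y⟩ hp
      simp only [hQ, coe_filter, Set.mem_ofPred_eq, mem_product, mem_range, Prod.mk.injEq] at hp ⊢
    · exact ⟨by omega, by omega, hrefl_dvd x y (by omega) (by omega) hp.2.2⟩
    · exact ⟨by omega, by omega, hrefl_dvd x y (by omega) (by omega) hp.2.2⟩
    · omega
    · omega
  have hunion := card_union_add_card_inter
    {p ∈ Q | p.1 + p.2 ≤ t * d ∧ d ∣ a * p.1 + b * p.2}
    {p ∈ Q | t * d ≤ p.1 + p.2 ∧ d ∣ a * p.1 + b * p.2}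
  have hU : {p ∈ Q | p.1 + p.2 ≤ t * d ∧ d ∣ a * p.1 + b * p.2} ∪
      {p ∈ Q | t * d ≤ p.1 + p.2 ∧ d ∣ a * p.1 + b * p.2} =
      {p ∈ Q | d ∣ a * p.1 + b * p.2} := by
    rw [← filter_or]
    refine filter_congr fun p _ => ?_
    have := le_total (p.1 + p.2) (t * d)
    tauto
  have hI : {p ∈ Q | p.1 + p.2 ≤ t * d ∧ d ∣ a * p.1 + b * p.2} ∩
      {p ∈ Q | t * d ≤ p.1 + p.2 ∧ d ∣ a * p.1 + b * p.2} =
      {p ∈ antidiagonal (t * d) | d ∣ a * p.1 + b * p.2} := by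
    ext ⟨x, y⟩
    simp only [hQ, mem_inter, mem_filter, mem_product, mem_range, HasAntidiagonal.mem_antidiagonal]
    constructor
    · rintro ⟨⟨_, h₁, h₂⟩, _, h₃, _⟩
      exact ⟨le_antisymm h₁ h₃, h₂⟩
    · rintro ⟨h₁, h₂⟩
      exact ⟨⟨by omega, by omega, h₂⟩, by omega, by omega, h₂⟩
  rw [hU, hI, hreflect, card_filter_closed_square_dvd d a b t hd h,
    card_filter_antidiagonal_dvd d a b t hd hab] at hunion
  rw [two_mul, ← hunion]
  ring

/-- The number of monomials of degree `t * d` invariant under `diag(1, e ^ a, e ^ b)`. -/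
theorem two_mul_ncard_invariant_monomials (d a b t : ℕ) (hd : 0 < d) (hab : a ≤ b)
    (h : Nat.gcd a (Nat.gcd b d) = 1) :
    2 * Set.ncard {y : ℕ × ℕ × ℕ |
        y.1 + y.2.1 + y.2.2 = t * d ∧ d ∣ a * y.2.1 + b * y.2.2} =
      t ^ 2 * d + t * (a.gcd d + b.gcd d + (b - a).gcd d) + 2 := by
  rw [← two_mul_card_filter_triangle_dvd d a b t hd hab h, ← Set.ncard_coe_finset]
  have hinj : Function.Injective fun p : ℕ × ℕ => (t * d - (p.1 + p.2), p) :=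
    fun p q hpq => congrArg Prod.snd hpq
  rw [← Set.ncard_image_of_injective _ hinj]
  congr 2
  ext ⟨x, y, z⟩
  simp only [coe_filter, mem_product, mem_range, Set.mem_ofPred_eq, Set.mem_image, Prod.mk.injEq,
    Prod.exists]
  constructor
  · rintro ⟨h₁, h₂⟩
    exact ⟨y, z, ⟨by omega, by omega, h₂⟩, by omega, rfl, rfl⟩
  · rintro ⟨y, z, ⟨_, h₁, h₂⟩, h₃, rfl, rfl⟩
    exact ⟨by omega, h₂⟩

theorem gcd_eq_gcd_div_gcd_of_coprime {a c d : ℕ} (h : Nat.Coprime c (a.gcd d)) :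
    c.gcd d = c.gcd (d / a.gcd d) := by
  conv_lhs => rw [← Nat.mul_div_cancel' (Nat.gcd_dvd_right a d)]
  exact h.symm.gcd_mul_left_cancel_right _

theorem int_gcd_mul_left_of_coprime {m : ℤ} {a n : ℕ} (h : Nat.Coprime a n) :
    Int.gcd (m * a) n = Int.gcd m n := by
  simp only [Int.gcd, Int.natAbs_mul, Int.natAbs_natCast]
  exact h.gcd_mul_right_cancel _

theorem int_gcd_eq_of_modEq {x y n : ℤ} (h : x ≡ y [ZMOD n]) : Int.gcd x n = Int.gcd y n := by
  rw [← Int.gcd_emod x, h.eq, Int.gcd_emod]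

theorem one_sub_X_pow_three_mul_mk (d θ : ℤ) :
    (1 - PowerSeries.X : PowerSeries ℤ) ^ 3 *
        PowerSeries.mk (fun t : ℕ => (t : ℤ) ^ 2 * d + t * θ + 2) =
      PowerSeries.C (d - θ + 2) * PowerSeries.X ^ 2 +
        PowerSeries.C (d + θ - 4) * PowerSeries.X + 2 := by
  set F := PowerSeries.mk (fun t : ℕ => (t : ℤ) ^ 2 * d + t * θ + 2) with hF
  have hexp : (1 - PowerSeries.X : PowerSeries ℤ) ^ 3 * F =
      F - PowerSeries.C 3 * (F * PowerSeries.X ^ 1) + PowerSeries.C 3 * (F * PowerSeries.X ^ 2)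
        - F * PowerSeries.X ^ 3 := by
    rw [show (PowerSeries.C (3 : ℤ)) = 3 from map_ofNat _ 3]
    ring
  rw [hexp, show (2 : PowerSeries ℤ) = PowerSeries.C 2 from (map_ofNat _ 2).symm]
  obtain ⟨p, hp⟩ : ∃ p, p = d - θ + 2 := ⟨_, rfl⟩
  obtain ⟨q, hq⟩ : ∃ q, q = d + θ - 4 := ⟨_, rfl⟩
  rw [← hp, ← hq]
  ext n
  simp only [map_add, map_sub, PowerSeries.coeff_C_mul, PowerSeries.coeff_mul_X_pow',
    PowerSeries.coeff_X, PowerSeries.coeff_C, hF, PowerSeries.coeff_mk]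
  rcases n with _ | _ | _ | n
  · simp
  · simp
    linarith
  · simp
    linarith
  · have h₁ : n + 1 + 1 + 1 - 1 = n + 2 := by omega
    have h₂ : n + 1 + 1 + 1 - 2 = n + 1 := by omega
    have h₃ : n + 1 + 1 + 1 - 3 = n := by omega
    rw [h₁, h₂, h₃]
    simp
    ring


/-- Theorem 4.11(ii): the Hilbert series of the GT-surface X_d is
(((d−θ+2)/2)z² + ((d+θ−4)/2)z + 1)/(1−z)³, stated (after clearing denominators
and multiplying by 2) as an identity of formal power series over ℤ. -/
theorem stmt8 (d a b : ℕ) (hd : 3 ≤ d) (ha : 0 < a) (hab : a < b) (hbd : b < d)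
    (hgcd : Nat.gcd a (Nat.gcd b d) = 1)
    (lam : ℕ) (hlam0 : 0 < lam) (hlamle : lam ≤ d / Nat.gcd a d)
    (hlamcong : b ≡ lam * (a / Nat.gcd a d) [MOD d / Nat.gcd a d]) :
    let θ : ℤ := (Nat.gcd a d : ℤ) + (Nat.gcd lam (d / Nat.gcd a d) : ℤ) +
      (Int.gcd ((lam : ℤ) - (Nat.gcd a d : ℤ)) ((d / Nat.gcd a d : ℕ) : ℤ) : ℤ)
    (1 - PowerSeries.X : PowerSeries ℤ) ^ 3 *
        PowerSeries.mk (fun t =>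
          (2 * Set.ncard {y : ℕ × ℕ × ℕ |
            y.1 + y.2.1 + y.2.2 = t * d ∧ d ∣ a * y.2.1 + b * y.2.2} : ℤ)) =
      PowerSeries.C ((d : ℤ) - θ + 2) * PowerSeries.X ^ 2 +
        PowerSeries.C ((d : ℤ) + θ - 4) * PowerSeries.X + 2 := by
  intro θ
  have hd0 : 0 < d := by omega
  have hg : 0 < a.gcd d := Nat.gcd_pos_of_pos_right _ hd0
  have hcop : Nat.Coprime b (a.gcd d) := by
    rw [Nat.Coprime, ← hgcd, ← Nat.gcd_assoc, ← Nat.gcd_assoc, Nat.gcd_comm b a]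
  have hcop' : Nat.Coprime (b - a) (a.gcd d) :=
    (Nat.gcd_sub_right_left_of_dvd _ hab.le (Nat.gcd_dvd_left a d)).trans hcop
  have hquot : Nat.Coprime (a / a.gcd d) (d / a.gcd d) := Nat.coprime_div_gcd_div_gcd hg
  have hb : b.gcd d = Nat.gcd lam (d / a.gcd d) := by
    rw [gcd_eq_gcd_div_gcd_of_coprime hcop, hlamcong.gcd_eq, hquot.gcd_mul_right_cancel]
  have hba : (b - a).gcd d = Int.gcd ((lam : ℤ) - a.gcd d) ((d / a.gcd d : ℕ) : ℤ) := by
    rw [gcd_eq_gcd_div_gcd_of_coprime hcop', ← int_gcd_mul_left_of_coprime hquot,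
      ← Int.gcd_natCast_natCast]
    refine int_gcd_eq_of_modEq ?_
    have hcong := (Int.natCast_modEq_iff.2 hlamcong).sub_right (a : ℤ)
    have ha' : (a : ℤ) = (a.gcd d : ℤ) * ((a / a.gcd d : ℕ) : ℤ) := by
      exact_mod_cast (Nat.mul_div_cancel' (Nat.gcd_dvd_left a d)).symm
    rw [Nat.cast_sub hab.le, sub_mul, ← ha', ← Nat.cast_mul]
    exact hcong
  have hθ : θ = ((a.gcd d + b.gcd d + (b - a).gcd d : ℕ) : ℤ) := by
    rw [hb, hba]
    push_cast
    rfl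
  rw [← one_sub_X_pow_three_mul_mk (d : ℤ) θ]
  congr 2
  funext t
  rw [hθ]
  exact_mod_cast two_mul_ncard_invariant_monomials d a b t hd0 hab.le hgcd
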